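/- arXiv:2108.08558 — 2 statements merged into one kernel-verified Lean document; each statement's English description precedes it below -/
import Mathlib

section
/- Let G be a connected undirected graph with at least two vertices and let T be a DFS spanning tree of G rooted at r. Then G is 2-edge-connected if and only if B(v) is nonempty for every vertex v ≠ r. -/
/-- An undirected multigraph `G` (parallel edges allowed, no self-loops) together with a
DFS spanning tree `T` rooted at `root`, where the vertices are identified with their DFS
preorder numbers (so they are `Fin n`, and the root gets the smallest number).
Tree edges are oriented from child to parent and back-edges from descendant to
(proper) ancestor. -/
structure DFSGraph where
  /-- number of vertices; the vertices are `Fin n`, numbered in DFS preorder -/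
  n : ℕ
  /-- the type indexing the edges (parallel edges are allowed) -/
  Edge : Type
  edgeFintype : Fintype Edge
  /-- the first endpoint (the descendant end) of each edge -/
  fst : Edge → Fin n
  /-- the second endpoint (the ancestor end) of each edge -/
  snd : Edge → Fin n
  /-- no self-loops -/
  noloop : ∀ e, fst e ≠ snd e
  /-- the root `r` of the DFS tree -/
  root : Fin n
  /-- in DFS preorder the root gets the smallest number -/
  root_le : ∀ v, root ≤ v
  /-- the parent function `p` of the DFS tree (arbitrary at the root) -/
  parent : Fin n → Fin n
  /-- the parent of a non-root vertex precedes it in preorder -/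
  parent_lt : ∀ v, v ≠ root → parent v < v
  /-- `tEdge v` is the tree edge `(v, p(v))`, for `v ≠ root` -/
  tEdge : Fin n → Edge
  tEdge_fst : ∀ v, v ≠ root → fst (tEdge v) = v
  tEdge_snd : ∀ v, v ≠ root → snd (tEdge v) = parent v
  tEdge_inj : ∀ u v, u ≠ root → v ≠ root → tEdge u = tEdge v → u = v
  /-- DFS property: every non-tree edge is a back-edge, i.e. it joins a vertex to an
  ancestor of it (a proper ancestor, by `noloop`) -/
  back_anc : ∀ e, (¬ ∃ v, v ≠ root ∧ e = tEdge v) →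
    Relation.ReflTransGen (fun x y => x ≠ root ∧ y = parent x) (fst e) (snd e)
  /-- preorder property: the descendants of any vertex form an interval of preorder
  numbers starting at that vertex -/
  preorder_interval : ∀ v u w : Fin n, v ≤ u → u ≤ w →
    Relation.ReflTransGen (fun x y => x ≠ root ∧ y = parent x) w v →
    Relation.ReflTransGen (fun x y => x ≠ root ∧ y = parent x) u v

namespace DFSGraph

variable (G : DFSGraph)

/-- `Anc a b`: `a` is an ancestor of `b` in `T` (every vertex is an ancestor of itself). -/
def Anc (a b : Fin G.n) : Prop :=
  Relation.ReflTransGen (fun x y => x ≠ G.root ∧ y = G.parent x) b a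

/-- `PAnc a b`: `a` is a proper ancestor of `b` in `T`. -/
def PAnc (a b : Fin G.n) : Prop := G.Anc a b ∧ a ≠ b

/-- `e` is an edge of the spanning tree `T`. -/
def IsTreeEdge (e : G.Edge) : Prop := ∃ v, v ≠ G.root ∧ e = G.tEdge v

/-- `e` is a back-edge (an edge of `G ∖ T`). -/
def IsBack (e : G.Edge) : Prop := ¬ G.IsTreeEdge e

/-- `B v`: the set of back-edges `(x, y)` with `x` a descendant of `v` and `y` a proper
ancestor of `v`. -/
def B (v : Fin G.n) : Set G.Edge :=
  {e | G.IsBack e ∧ G.Anc v (G.fst e) ∧ G.PAnc (G.snd e) v}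

/-- `b_count(v) = |B(v)|`. -/
noncomputable def bcount (v : Fin G.n) : ℕ := (G.B v).ncard

/-- adjacency in `G` after removing the edge set `S` -/
def AdjOff (S : Set G.Edge) (x y : Fin G.n) : Prop :=
  ∃ e, e ∉ S ∧ ((G.fst e = x ∧ G.snd e = y) ∨ (G.fst e = y ∧ G.snd e = x))

/-- `G ∖ S` is connected -/
def ConnectedOff (S : Set G.Edge) : Prop :=
  ∀ x y, Relation.ReflTransGen (G.AdjOff S) x y

/-- `S` is an edge cut of `G`: removing `S` disconnects `G`. -/
def IsCut (S : Set G.Edge) : Prop := ¬ G.ConnectedOff S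

/-- `G` is `k`-edge-connected: it has no cut of fewer than `k` edges. -/
def EdgeConn (k : ℕ) : Prop := ∀ S : Set G.Edge, S.ncard < k → ¬ G.IsCut S

/-- `IsLow1 v y`: `y = low1(v) = min {y | ∃ (x,y) ∈ B(v)}`. -/
def IsLow1 (v y : Fin G.n) : Prop :=
  (∃ e ∈ G.B v, G.snd e = y) ∧ ∀ e ∈ G.B v, y ≤ G.snd e

/-- `IsHigh v y`: `y = high(v) = max {y | ∃ (x,y) ∈ B(v)}`. -/
def IsHigh (v y : Fin G.n) : Prop :=
  (∃ e ∈ G.B v, G.snd e = y) ∧ ∀ e ∈ G.B v, G.snd e ≤ y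

/-- `IsLow2 v y`: `y = low2(v)`, the minimum lower end of the back-edges in `B(v)` minus
one (fixed, but arbitrary) back-edge `(low1D(v), low1(v))` attaining `low1(v)`. -/
def IsLow2 (v y : Fin G.n) : Prop :=
  ∃ f ∈ G.B v, (∀ g ∈ G.B v, G.snd f ≤ G.snd g) ∧
    (∃ e ∈ G.B v, e ≠ f ∧ G.snd e = y) ∧
    (∀ e ∈ G.B v, e ≠ f → y ≤ G.snd e)

/-- `IsL1 v y`: `y = l1(v) = min ({y | (v,y) is a back-edge} ∪ {v})`. -/
def IsL1 (v y : Fin G.n) : Prop :=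
  (y = v ∨ ∃ e, G.IsBack e ∧ G.fst e = v ∧ G.snd e = y) ∧
  y ≤ v ∧ (∀ e, G.IsBack e → G.fst e = v → y ≤ G.snd e)

/-- `IsL2 v y`: `y = l2(v)`, defined as `l1(v)` but after removing one (fixed, but
arbitrary) back-edge `(v, l1(v))` attaining `l1(v)`, if such a back-edge exists. -/
def IsL2 (v y : Fin G.n) : Prop :=
  ((¬ ∃ e, G.IsBack e ∧ G.fst e = v) ∧ y = v) ∨
  (∃ f, G.IsBack f ∧ G.fst f = v ∧
    (∀ g, G.IsBack g → G.fst g = v → G.snd f ≤ G.snd g) ∧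
    (y = v ∨ ∃ e, G.IsBack e ∧ G.fst e = v ∧ e ≠ f ∧ G.snd e = y) ∧
    y ≤ v ∧
    (∀ e, G.IsBack e → G.fst e = v → e ≠ f → y ≤ G.snd e))

/-- `z` is the nearest common ancestor of the set of vertices `S`. -/
def IsNCA (S : Set (Fin G.n)) (z : Fin G.n) : Prop :=
  (∀ x ∈ S, G.Anc z x) ∧ ∀ z', (∀ x ∈ S, G.Anc z' x) → G.Anc z' z

/-- `IsM v m`: `m = M(v)`, the nearest common ancestor of all higher ends of back-edges
in `B(v)`. -/
def IsM (v m : Fin G.n) : Prop :=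
  G.IsNCA {x | ∃ e ∈ G.B v, G.fst e = x} m

/-- `IsMtilde v m`: `m = M̃(v)`, the nearest common ancestor of all higher ends of
back-edges in `B(v)` that are proper descendants of `M(v)` (defined only if such a
higher end exists). -/
def IsMtilde (v m : Fin G.n) : Prop :=
  ∃ mv, G.IsM v mv ∧
    {x | ∃ e ∈ G.B v, G.fst e = x ∧ G.PAnc mv x}.Nonempty ∧
    G.IsNCA {x | ∃ e ∈ G.B v, G.fst e = x ∧ G.PAnc mv x} m

/-- `c` is a child of `p` in `T`. -/
def IsChild (p c : Fin G.n) : Prop := c ≠ G.root ∧ G.parent c = p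

/-- `low1(c) ≤ low1(c')` (stated relationally). -/
def Low1LE (c c' : Fin G.n) : Prop :=
  ∀ y y', G.IsLow1 c y → G.IsLow1 c' y' → y ≤ y'

/-- `c = c₁(p)`: `c` is a `low1` child of `p`, i.e. a child of `p` minimizing `low1`. -/
def IsC1 (p c : Fin G.n) : Prop :=
  G.IsChild p c ∧ ∀ c', G.IsChild p c' → G.Low1LE c c'

/-- `c = c₂(p)`: `c` is a `low2` child of `p`, i.e. a child of `p` minimizing `low1`
among the children different from the (fixed) `low1` child. -/
def IsC2 (p c : Fin G.n) : Prop :=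
  ∃ c1, G.IsC1 p c1 ∧ G.IsChild p c ∧ c ≠ c1 ∧
    ∀ c', G.IsChild p c' → c' ≠ c1 → G.Low1LE c c'

/-- `c = c₃(p)`: `c` is a `low3` child of `p`. -/
def IsC3 (p c : Fin G.n) : Prop :=
  ∃ c1 c2, G.IsC1 p c1 ∧
    (G.IsChild p c2 ∧ c2 ≠ c1 ∧ ∀ c', G.IsChild p c' → c' ≠ c1 → G.Low1LE c2 c') ∧
    G.IsChild p c ∧ c ≠ c1 ∧ c ≠ c2 ∧
    (∀ c', G.IsChild p c' → c' ≠ c1 → c' ≠ c2 → G.Low1LE c c')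

/-- `IsMlow1 v m`: `m = M_low1(v)`, the nearest common ancestor of all higher ends of
back-edges in `B(v)` that are descendants of the `low1` child of `M(v)` (defined only
if such a higher end exists). -/
def IsMlow1 (v m : Fin G.n) : Prop :=
  ∃ mv c1, G.IsM v mv ∧ G.IsC1 mv c1 ∧
    {x | ∃ e ∈ G.B v, G.fst e = x ∧ G.Anc c1 x}.Nonempty ∧
    G.IsNCA {x | ∃ e ∈ G.B v, G.fst e = x ∧ G.Anc c1 x} m

/-- `IsMlow2 v m`: `m = M_low2(v)`, the nearest common ancestor of all higher ends of
back-edges in `B(v)` that are descendants of the `low2` child of `M(v)` (defined only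
if such a higher end exists). -/
def IsMlow2 (v m : Fin G.n) : Prop :=
  ∃ mv c2, G.IsM v mv ∧ G.IsC2 mv c2 ∧
    {x | ∃ e ∈ G.B v, G.fst e = x ∧ G.Anc c2 x}.Nonempty ∧
    G.IsNCA {x | ∃ e ∈ G.B v, G.fst e = x ∧ G.Anc c2 x} m

/-- `IsNextM v w`: `w = nextM(v)`, the maximum vertex `w < v` with `M(w) = M(v)`. -/
def IsNextM (v w : Fin G.n) : Prop :=
  ∃ m, G.IsM v m ∧ G.IsM w m ∧ w < v ∧ ∀ w', w' < v → G.IsM w' m → w' ≤ w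

/-- `IsLowM v l`: `l = low_M(v) = min {y | ∃ (x,y) ∈ B(v) ∖ B(nextM(v))}`. -/
def IsLowM (v l : Fin G.n) : Prop :=
  ∃ w, G.IsNextM v w ∧ (∃ e ∈ G.B v, e ∉ G.B w ∧ G.snd e = l) ∧
    ∀ e ∈ G.B v, e ∉ G.B w → l ≤ G.snd e

end DFSGraph

namespace DFSGraph

variable {G : DFSGraph}

theorem Anc.le {a b : Fin G.n} (h : G.Anc a b) : a ≤ b := by
  induction h using Relation.ReflTransGen.head_induction_on with
  | refl => exact le_rfl
  | head h _ ih =>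
    obtain ⟨hx, rfl⟩ := h
    exact ih.trans (G.parent_lt _ hx).le

/-- Two ancestors of a common vertex are comparable. -/
theorem Anc.total {a b x : Fin G.n} (ha : G.Anc a x) (hb : G.Anc b x) :
    G.Anc a b ∨ G.Anc b a :=
  (Relation.ReflTransGen.total_of_right_unique
    (fun _ _ _ h h' => h.2.trans h'.2.symm) ha hb).symm

theorem anc_parent_iff {v u : Fin G.n} (hu : u ≠ G.root) (huv : u ≠ v) :
    G.Anc v (G.parent u) ↔ G.Anc v u := by
  refine ⟨fun h => Relation.ReflTransGen.head ⟨hu, rfl⟩ h, fun h => ?_⟩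
  rcases Relation.ReflTransGen.cases_head h with h | ⟨c, ⟨_, rfl⟩, hc⟩
  · exact absurd h huv
  · exact hc

theorem AdjOff.symm {S : Set G.Edge} {x y : Fin G.n} (h : G.AdjOff S x y) : G.AdjOff S y x :=
  let ⟨e, he, h⟩ := h
  ⟨e, he, h.symm⟩

theorem reachable_symm {S : Set G.Edge} {x y : Fin G.n}
    (h : Relation.ReflTransGen (G.AdjOff S) x y) : Relation.ReflTransGen (G.AdjOff S) y x := by
  induction h with
  | refl => exact Relation.ReflTransGen.refl
  | tail _ h ih => exact ih.head h.symm

theorem adjOff_parent {S : Set G.Edge} {v : Fin G.n} (hv : v ≠ G.root) (h : G.tEdge v ∉ S) :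
    G.AdjOff S v (G.parent v) :=
  ⟨G.tEdge v, h, Or.inl ⟨G.tEdge_fst v hv, G.tEdge_snd v hv⟩⟩

/-- If `B v` is empty, the tree edge above `v` is the only edge leaving the subtree of `v`. -/
theorem anc_fst_iff_snd {v : Fin G.n} (hB : G.B v = ∅) {e : G.Edge} (he : e ≠ G.tEdge v) :
    G.Anc v (G.fst e) ↔ G.Anc v (G.snd e) := by
  by_cases ht : G.IsTreeEdge e
  · obtain ⟨u, hu, rfl⟩ := ht
    rw [G.tEdge_fst u hu, G.tEdge_snd u hu]
    exact (anc_parent_iff hu fun h => he (h ▸ rfl)).symm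
  · have hs : G.Anc (G.snd e) (G.fst e) := G.back_anc e ht
    refine ⟨fun h => ?_, fun h => hs.trans h⟩
    rcases h.total hs with h' | h'
    · exact h'
    · by_contra hn
      have : e ∈ G.B v := ⟨ht, h, h', fun heq => hn (heq ▸ Relation.ReflTransGen.refl)⟩
      simp [hB] at this

/-- Removing the tree edge above `v` leaves the subtree of `v` connected. -/
theorem reachable_of_anc {S : Set G.Edge} (hS : S.Subsingleton) {v x : Fin G.n}
    (hv : v ≠ G.root) (hvS : G.tEdge v ∈ S) (h : G.Anc v x) :
    Relation.ReflTransGen (G.AdjOff S) x v := by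
  induction h using Relation.ReflTransGen.head_induction_on with
  | refl => exact Relation.ReflTransGen.refl
  | @head x _ h _ ih =>
    obtain ⟨hx, rfl⟩ := h
    by_cases hxv : x = v
    · rw [hxv]
    · exact ih.head (adjOff_parent hx fun hxS => hxv (G.tEdge_inj x v hx hv (hS hxS hvS)))

theorem reachable_root {S : Set G.Edge} (hS : S.Subsingleton)
    (hB : ∀ v : Fin G.n, v ≠ G.root → (G.B v).Nonempty) (v : Fin G.n) :
    Relation.ReflTransGen (G.AdjOff S) v G.root := by
  induction v using WellFoundedLT.induction with
  | ind v ih =>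
    by_cases hv : v = G.root
    · rw [hv]
    by_cases hvS : G.tEdge v ∈ S
    · obtain ⟨e, hback, hfst, hsnd, hne⟩ := hB v hv
      have heS : e ∉ S := fun heS => hback ⟨v, hv, hS heS hvS⟩
      have hup : Relation.ReflTransGen (G.AdjOff S) v (G.fst e) :=
        reachable_symm (reachable_of_anc hS hv hvS hfst)
      exact (hup.tail ⟨e, heS, Or.inl ⟨rfl, rfl⟩⟩).trans (ih _ (lt_of_le_of_ne hsnd.le hne))
    · exact (ih _ (G.parent_lt v hv)).head (adjOff_parent hv hvS)

end DFSGraph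

/-- Property 2.1, first part: Let `G` be a connected undirected graph
with at least two vertices and `T` a DFS spanning tree of `G` rooted at `r`. Then `G` is
`2`-edge-connected if and only if `B(v)` is nonempty for every vertex `v ≠ r`. -/
theorem stmt0 (G : DFSGraph) (hn : 2 ≤ G.n) (hconn : G.ConnectedOff ∅) :
    G.EdgeConn 2 ↔ ∀ v : Fin G.n, v ≠ G.root → (G.B v).Nonempty := by
  constructor
  · intro h v hv
    by_contra hB
    rw [Set.not_nonempty_iff_eq_empty] at hB
    refine h {G.tEdge v} (by simp) fun hc => ?_
    have key : ∀ y, Relation.ReflTransGen (G.AdjOff {G.tEdge v}) v y → G.Anc v y := by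
      intro y hy
      induction hy with
      | refl => exact Relation.ReflTransGen.refl
      | tail _ h ih =>
        obtain ⟨e, he, ⟨rfl, rfl⟩ | ⟨rfl, rfl⟩⟩ := h
        · exact (DFSGraph.anc_fst_iff_snd hB he).1 ih
        · exact (DFSGraph.anc_fst_iff_snd hB he).2 ih
    exact hv (le_antisymm (key _ (hc v G.root)).le (G.root_le v))
  · intro hB S hS hcut
    have := G.edgeFintype
    have hsub : S.Subsingleton := fun a ha b hb =>
      (Set.ncard_le_one S.toFinite).1 (Nat.lt_succ_iff.1 hS) a ha b hb
    exact hcut fun x y => (DFSGraph.reachable_root hsub hB x).trans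
      (DFSGraph.reachable_symm (DFSGraph.reachable_root hsub hB y))
end

section
/- Let G be a connected undirected graph with at least two vertices and let T be a DFS spanning tree of G rooted at r. If G is 3-edge-connected, then b_count(v) > 1 for every vertex v ≠ r. -/
namespace DFSGraph

variable {G : DFSGraph}

theorem Anc.trans {a b c : Fin G.n} (hab : G.Anc a b) (hbc : G.Anc b c) : G.Anc a c :=
  Relation.ReflTransGen.trans hbc hab

theorem anc_parent {u : Fin G.n} (hu : u ≠ G.root) : G.Anc (G.parent u) u :=
  Relation.ReflTransGen.single ⟨hu, rfl⟩

theorem Anc.eq_or_anc_parent {v u : Fin G.n} (h : G.Anc v u) :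
    u = v ∨ (u ≠ G.root ∧ G.Anc v (G.parent u)) := by
  rcases Relation.ReflTransGen.cases_head h with h | ⟨w, ⟨hu, rfl⟩, hw⟩
  · exact Or.inl h
  · exact Or.inr ⟨hu, hw⟩

/-- The ancestors of a vertex form a chain. -/
theorem Anc.total_s1 {a b c : Fin G.n} (hac : G.Anc a c) (hbc : G.Anc b c) :
    G.Anc a b ∨ G.Anc b a := by
  refine (Relation.ReflTransGen.total_of_right_unique ?_ hac hbc).symm
  rintro x y z ⟨-, rfl⟩ ⟨-, rfl⟩
  rfl

theorem not_anc_root {v : Fin G.n} (hv : v ≠ G.root) : ¬ G.Anc v G.root := fun h =>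
  h.eq_or_anc_parent.elim (fun h => hv h.symm) fun h => h.1 rfl

/-- An edge other than `(v, p(v))` and those of `B v` does not leave the subtree of `v`. -/
theorem anc_fst_iff_anc_snd {v : Fin G.n} {e : G.Edge} (he : e ∉ insert (G.tEdge v) (G.B v)) :
    G.Anc v (G.fst e) ↔ G.Anc v (G.snd e) := by
  rw [Set.mem_insert_iff, not_or] at he
  obtain ⟨hev, heB⟩ := he
  by_cases ht : G.IsTreeEdge e
  · obtain ⟨u, hu, rfl⟩ := ht
    rw [G.tEdge_fst u hu, G.tEdge_snd u hu]
    refine ⟨fun h => ?_, fun h => h.trans (anc_parent hu)⟩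
    rcases h.eq_or_anc_parent with rfl | h
    · exact absurd rfl hev
    · exact h.2
  · have hanc : G.Anc (G.snd e) (G.fst e) := G.back_anc e ht
    refine ⟨fun h => ?_, fun h => h.trans hanc⟩
    rcases h.total_s1 hanc with h' | h'
    · exact h'
    · by_cases hs : G.snd e = v
      · exact hs ▸ Relation.ReflTransGen.refl
      · exact absurd ⟨ht, h, h', hs⟩ heB

theorem isCut_insert_tEdge_B {v : Fin G.n} (hv : v ≠ G.root) :
    G.IsCut (insert (G.tEdge v) (G.B v)) := by
  intro hc
  suffices ∀ x, Relation.ReflTransGen (G.AdjOff (insert (G.tEdge v) (G.B v))) v x → G.Anc v x from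
    not_anc_root hv (this _ (hc v G.root))
  intro x hx
  induction hx with
  | refl => exact Relation.ReflTransGen.refl
  | tail _ hstep ih =>
    obtain ⟨e, he, ⟨rfl, rfl⟩ | ⟨rfl, rfl⟩⟩ := hstep
    · exact (anc_fst_iff_anc_snd he).1 ih
    · exact (anc_fst_iff_anc_snd he).2 ih

end DFSGraph

/-- Property 2.1, second part: Let `G` be a connected undirected graph
with at least two vertices and `T` a DFS spanning tree of `G` rooted at `r`. If `G` is
`3`-edge-connected, then `b_count(v) > 1` for every vertex `v ≠ r`. -/
theorem stmt1 (G : DFSGraph) (hn : 2 ≤ G.n) (hconn : G.ConnectedOff ∅)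
    (h3 : G.EdgeConn 3) :
    ∀ v : Fin G.n, v ≠ G.root → 1 < G.bcount v := by
  intro v hv
  by_contra! hle
  refine h3 _ ?_ (DFSGraph.isCut_insert_tEdge_B hv)
  calc (insert (G.tEdge v) (G.B v)).ncard ≤ (G.B v).ncard + 1 := Set.ncard_insert_le _ _
    _ < 3 := by
      have : (G.B v).ncard ≤ 1 := hle
      omega
end
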